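/- arXiv:2008.13741 — 8 statements merged into one kernel-verified Lean document; each statement's English description precedes it below -/
import Mathlib

section
/- Let f : {0,1}^n → {0,1} be a Boolean function and let 1 ≤ k < n. Then P_k(f) ≤ (1/2)·(1 + P_{k-1}(f)). -/
open Finset

/-- The input set `c` (a partial assignment of values to variables) collectively
canalizes the Boolean function `f`: some output value `b` is forced whenever all
variables in the domain of `c` take the prescribed values. -/
def CanalizesOn {n : ℕ} (f : (Fin n → Bool) → Bool) (c : Fin n → Option Bool) : Prop :=
  ∃ b : Bool, ∀ x : Fin n → Bool, (∀ i : Fin n, ∀ a : Bool, c i = some a → x i = a) → f x = b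

/-- `canalizingProportion n f k` = P_k(f): the number of canalizing k-sets divided by
the total number 2^k * C(n,k) of k-sets. A k-set is encoded as a partial assignment
`c : Fin n → Option Bool` which is `some` on exactly `k` coordinates. -/
noncomputable def canalizingProportion (n : ℕ) (f : (Fin n → Bool) → Bool) (k : ℕ) : ℝ :=
  (Nat.card {c : Fin n → Option Bool //
      (Finset.univ.filter fun i => (c i).isSome).card = k ∧ CanalizesOn f c} : ℝ) /
    (2 ^ k * (n.choose k) : ℝ)

namespace PkStep

/-- number of fixed coordinates -/
def sz {n : ℕ} (c : Fin n → Option Bool) : ℕ := (Finset.univ.filter fun i => (c i).isSome).card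

/-- the free coordinates -/
def free {n : ℕ} (c : Fin n → Option Bool) : Finset (Fin n) := Finset.univ.filter fun i => c i = none

lemma sz_add_free {n : ℕ} (c : Fin n → Option Bool) : sz c + (free c).card = n := by
  have h := Finset.card_filter_add_card_filter_not (s := (Finset.univ : Finset (Fin n)))
    (fun i => ((c i).isSome : Prop))
  simp only [Finset.card_univ, Fintype.card_fin] at h
  have : free c = Finset.univ.filter fun i => ¬ ((c i).isSome : Prop) := by
    ext i; simp [free]
  rw [this]; exact h

lemma sz_update {n m : ℕ} (c : Fin n → Option Bool) (i : Fin n) (hi : (c i).isSome)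
    (h : sz c = m + 1) : sz (Function.update c i none) = m := by
  have : (Finset.univ.filter fun j => ((Function.update c i none) j).isSome)
      = (Finset.univ.filter fun j => (c j).isSome).erase i := by
    ext j
    by_cases hj : j = i
    · subst hj; simp
    · simp [hj]
  unfold sz at *
  rw [this, Finset.card_erase_of_mem (by simpa using hi), h]; rfl

open Classical in
/-- one-step extensions of `c` satisfying `P` -/
noncomputable def ext1 {n : ℕ} (P : (Fin n → Option Bool) → Prop) (c : Fin n → Option Bool) :
    Finset (Fin n × Bool) :=
  Finset.univ.filter fun p => c p.1 = none ∧ P (Function.update c p.1 (some p.2))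

open Classical in
lemma count {n : ℕ} (P : (Fin n → Option Bool) → Prop) (m : ℕ) :
    (m + 1) * (Finset.univ.filter fun c : Fin n → Option Bool => sz c = m + 1 ∧ P c).card
      ≤ ∑ c ∈ Finset.univ.filter (fun c : Fin n → Option Bool => sz c = m), (ext1 P c).card := by
  have h1 : (m + 1) * (Finset.univ.filter fun c : Fin n → Option Bool => sz c = m + 1 ∧ P c).card
      = ((Finset.univ.filter fun c : Fin n → Option Bool => sz c = m + 1 ∧ P c).sigma
          (fun c => Finset.univ.filter fun i => ((c i).isSome : Prop))).card := by
    rw [Finset.card_sigma, Finset.sum_congr rfl (g := fun _ => m + 1)]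
    · simp [mul_comm]
    · intro c hc
      simp only [Finset.mem_filter] at hc
      exact hc.2.1
  rw [h1, ← Finset.card_sigma]
  refine Finset.card_le_card_of_injOn
    (fun q => ⟨Function.update q.1 q.2 none, (q.2, (q.1 q.2).getD false)⟩) ?_ ?_
  · rintro ⟨c, i⟩ hq
    simp only [Finset.coe_sigma, Set.mem_sigma_iff, Finset.mem_coe, Finset.mem_filter,
      Finset.mem_univ, true_and] at hq
    obtain ⟨⟨hs, hP⟩, hi⟩ := hq
    obtain ⟨a, ha⟩ := Option.isSome_iff_exists.1 hi
    have : Function.update c i (some a) = c := by rw [← ha]; simp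
    simp only [Finset.coe_sigma, Set.mem_sigma_iff, Finset.mem_coe, Finset.mem_filter,
      Finset.mem_univ, true_and, ext1]
    refine ⟨sz_update c i hi hs, by simp, ?_⟩
    simpa [ha, this] using hP
  · rintro ⟨c, i⟩ hq ⟨c', i'⟩ hq' h
    simp only [Finset.coe_sigma, Set.mem_sigma_iff, Finset.mem_coe, Finset.mem_filter,
      Finset.mem_univ, true_and] at hq hq'
    simp only [Sigma.mk.injEq, heq_eq_eq, Prod.mk.injEq] at h
    obtain ⟨h1, rfl, h3⟩ := h
    obtain ⟨a, ha⟩ := Option.isSome_iff_exists.1 hq.2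
    obtain ⟨a', ha'⟩ := Option.isSome_iff_exists.1 hq'.2
    have : c = c' := by
      funext j
      by_cases hj : j = i
      · subst hj; simp [ha, ha'] at h3; rw [ha, ha', h3]
      · have := congrFun h1 j; simpa [hj] using this
    subst this; rfl

lemma ext1_le_two {n : ℕ} (P : (Fin n → Option Bool) → Prop) (c : Fin n → Option Bool) :
    (ext1 P c).card ≤ 2 * (free c).card := by
  have : ext1 P c ⊆ free c ×ˢ (Finset.univ : Finset Bool) := by
    intro p hp
    simp only [ext1, free, Finset.mem_filter, Finset.mem_product, Finset.mem_univ, true_and,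
      and_true] at *
    exact hp.1
  have h := Finset.card_le_card this
  rw [Finset.card_product] at h
  simp at h; omega

lemma canal_of {n : ℕ} (f : (Fin n → Bool) → Bool) (c : Fin n → Option Bool) (i j : Fin n)
    (hij : j ≠ i) (a : Bool) (hi : c i = none) (hj : c j = none)
    (h : ∀ v, CanalizesOn f (Function.update c i (some v)))
    (h' : CanalizesOn f (Function.update c j (some a))) : CanalizesOn f c := by
  obtain ⟨b, hb⟩ := h'
  refine ⟨b, fun x hx => ?_⟩
  obtain ⟨b', hb'⟩ := h (x i)
  have e1 : f x = b' := by
    apply hb'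
    intro l w hl
    by_cases hli : l = i
    · subst hli; simpa using hl
    · rw [Function.update_of_ne hli] at hl; exact hx l w hl
  have e2 : f (Function.update x j a) = b' := by
    apply hb'
    intro l w hl
    by_cases hli : l = i
    · subst hli; rw [Function.update_of_ne hij.symm]; simpa using hl
    · rw [Function.update_of_ne hli] at hl
      have : l ≠ j := by rintro rfl; simp [hj] at hl
      rw [Function.update_of_ne this]; exact hx l w hl
  have e3 : f (Function.update x j a) = b := by
    apply hb
    intro l w hl
    by_cases hlj : l = j
    · subst hlj; simpa using hl
    · rw [Function.update_of_ne hlj] at hl ⊢; exact hx l w hl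
  rw [e1, ← e2, e3]

lemma ext1_le_one {n : ℕ} (f : (Fin n → Bool) → Bool) (c : Fin n → Option Bool)
    (hc : ¬ CanalizesOn f c) (h2 : 2 ≤ (free c).card) :
    (ext1 (CanalizesOn f) c).card ≤ (free c).card := by
  by_cases hex : ∃ i, ∀ v, (i, v) ∈ ext1 (CanalizesOn f) c
  · obtain ⟨i, hi⟩ := hex
    have hs : ext1 (CanalizesOn f) c ⊆ {(i, false), (i, true)} := by
      rintro ⟨j, a⟩ hj
      by_cases hij : j = i
      · subst hij; cases a <;> simp
      · simp only [ext1, Finset.mem_filter, Finset.mem_univ, true_and] at hi hj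
        exact absurd (canal_of f c i j hij a (hi a).1 hj.1 (fun v => (hi v).2) hj.2) hc
    exact ((Finset.card_le_card hs).trans Finset.card_le_two).trans h2
  · refine Finset.card_le_card_of_injOn Prod.fst ?_ ?_
    · rintro p hp
      simp only [ext1, free, Finset.coe_filter, Finset.mem_univ, true_and, Set.mem_ofPred_eq] at *
      exact hp.1
    · rintro ⟨i, a⟩ hp ⟨j, b⟩ hq h
      obtain rfl : i = j := h
      by_contra hne
      have hab : a ≠ b := fun h => hne (by rw [h])
      refine hex ⟨i, fun v => ?_⟩
      by_cases hv : v = a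
      · subst hv; exact hp
      · have : v = b := by revert hv hab; cases v <;> cases a <;> cases b <;> simp
        subst this; exact hq

lemma total_le {n : ℕ} (m : ℕ) :
    (Finset.univ.filter fun c : Fin n → Option Bool => sz c = m).card ≤ 2 ^ m * n.choose m := by
  induction m with
  | zero =>
    simp only [pow_zero, Nat.choose_zero_right, mul_one]
    refine Finset.card_le_one.2 ?_
    intro c hc d hd
    simp only [sz, Finset.mem_filter, Finset.mem_univ, true_and, Finset.card_eq_zero,
      Finset.filter_eq_empty_iff] at hc hd
    funext i
    have h1 := @hc i
    have h2 := @hd i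
    simp at h1 h2; rw [h1, h2]
  | succ m ih =>
    have h := count (n := n) (fun _ => True) m
    have h2 : ∑ c ∈ Finset.univ.filter (fun c : Fin n → Option Bool => sz c = m),
        (ext1 (fun _ => True) c).card ≤ (2 ^ m * n.choose m) * (2 * (n - m)) := by
      refine (Finset.sum_le_card_nsmul _ _ (2 * (n - m)) ?_).trans ?_
      · intro c hc
        simp only [Finset.mem_filter, Finset.mem_univ, true_and] at hc
        have := sz_add_free c
        have := ext1_le_two (fun _ => True) c
        omega
      · rw [smul_eq_mul]; exact Nat.mul_le_mul_right _ ih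
    simp only [and_true] at h
    have h3 := Nat.choose_succ_right_eq n m
    refine le_of_mul_le_mul_left (a := m + 1) ?_ (Nat.succ_pos m)
    calc _ ≤ _ := by convert h
      _ ≤ _ := h2
      _ = 2 ^ (m + 1) * (n.choose m * (n - m)) := by ring
      _ = _ := by rw [← h3]; ring

open Classical in
lemma key {n : ℕ} (f : (Fin n → Bool) → Bool) (m : ℕ) (hm : m + 1 < n) :
    (m + 1) * (Finset.univ.filter fun c : Fin n → Option Bool =>
        sz c = m + 1 ∧ CanalizesOn f c).card
      ≤ (n - m) * (2 ^ m * n.choose m + (Finset.univ.filter fun c : Fin n → Option Bool =>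
        sz c = m ∧ CanalizesOn f c).card) := by
  refine (count (CanalizesOn f) m).trans ?_
  have : ∀ c ∈ Finset.univ.filter (fun c : Fin n → Option Bool => sz c = m),
      (ext1 (CanalizesOn f) c).card ≤ (n - m) * (1 + if CanalizesOn f c then 1 else 0) := by
    intro c hc
    simp only [Finset.mem_filter, Finset.mem_univ, true_and] at hc
    have h0 := sz_add_free c
    have hfr : (free c).card = n - m := by omega
    split_ifs with h
    · have := ext1_le_two (CanalizesOn f) c
      rw [hfr] at this; omega
    · have := ext1_le_one f c h (by omega)
      rw [hfr] at this; omega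
  refine (Finset.sum_le_sum this).trans ?_
  rw [← Finset.mul_sum, Finset.sum_add_distrib, ← Finset.card_eq_sum_ones, ← Finset.card_filter,
    Finset.filter_filter]
  gcongr
  exact total_le m

end PkStep

theorem Pk_upper_step (n k : ℕ) (f : (Fin n → Bool) → Bool) (hk1 : 1 ≤ k) (hkn : k < n) :
    canalizingProportion n f k ≤ (1 / 2) * (1 + canalizingProportion n f (k - 1)) := by
  classical
  obtain ⟨m, rfl⟩ : ∃ m, k = m + 1 := ⟨k - 1, by omega⟩
  have hkey := PkStep.key f m hkn
  have hch := Nat.choose_succ_right_eq n m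
  have hp1 : 0 < n.choose m := Nat.choose_pos (by omega)
  have hp2 : 0 < n.choose (m + 1) := Nat.choose_pos (by omega)
  have hd : 0 < n - m := by omega
  unfold canalizingProportion
  rw [Nat.add_sub_cancel, Nat.card_eq_fintype_card, Nat.card_eq_fintype_card,
    Fintype.card_subtype, Fintype.card_subtype]
  unfold PkStep.sz at hkey
  generalize (Finset.univ.filter fun c : Fin n → Option Bool =>
    (Finset.univ.filter fun i => (c i).isSome).card = m + 1 ∧ CanalizesOn f c).card = A at *
  generalize (Finset.univ.filter fun c : Fin n → Option Bool =>
    (Finset.univ.filter fun i => (c i).isSome).card = m ∧ CanalizesOn f c).card = B at *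
  generalize n.choose (m + 1) = X at *
  generalize n.choose m = Y at *
  generalize n - m = d at *
  have hkey' : ((m : ℝ) + 1) * A ≤ d * (2 ^ m * Y + B) := by exact_mod_cast hkey
  have hch' : (X : ℝ) * (m + 1) = Y * d := by exact_mod_cast hch
  have hX : (0 : ℝ) < X := by exact_mod_cast hp2
  have hY : (0 : ℝ) < Y := by exact_mod_cast hp1
  have hD : (0 : ℝ) < d := by exact_mod_cast hd
  have hm : (0 : ℝ) < (m : ℝ) + 1 := by positivity
  have e : (1 / 2 : ℝ) * (1 + B / (2 ^ m * Y)) = (2 ^ m * Y + B) / (2 ^ (m + 1) * Y) := by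
    field_simp; ring
  rw [e, div_le_div_iff₀ (by positivity) (by positivity)]
  refine le_of_mul_le_mul_left ?_ (mul_pos hD hm)
  calc (d * ((m : ℝ) + 1)) * (A * (2 ^ (m + 1) * Y))
      = (((m : ℝ) + 1) * A) * (d * (2 ^ (m + 1) * Y)) := by ring
    _ ≤ (d * (2 ^ m * Y + B)) * (d * (2 ^ (m + 1) * Y)) := by gcongr
    _ = (d * (2 ^ m * Y + B)) * (2 ^ (m + 1) * (Y * d)) := by ring
    _ = _ := by rw [← hch']; ring
end

section
/- If f : {0,1}^n → {0,1} is a non-constant Boolean function, then P_k(f) ≤ 1 − 1/2^k for all 0 ≤ k < n. -/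
open Finset

lemma card_split {n : ℕ} (P : (Fin (n+1) → Option Bool) → Prop) [DecidablePred P] :
    (univ.filter P).card = (univ.filter fun c : Fin n → Option Bool => P (Fin.cons none c)).card
      + (univ.filter fun c : Fin n → Option Bool => P (Fin.cons (some true) c)).card
      + (univ.filter fun c : Fin n → Option Bool => P (Fin.cons (some false) c)).card := by
  have h := Fintype.sum_equiv (Fin.consEquiv fun _ : Fin (n+1) => Option Bool)
    (fun p => if P (Fin.cons p.1 p.2) then 1 else 0) (fun c => if P c then 1 else 0)
    (fun p => rfl)
  simp only [Finset.card_filter]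
  rw [← h, Fintype.sum_prod_type]
  simp [Fintype.sum_option, add_assoc]

/-- number of fixed coordinates -/
def nfix {n : ℕ} (c : Fin n → Option Bool) : ℕ :=
  (Finset.univ.filter fun i => (c i).isSome).card

lemma nfix_none {n : ℕ} (c : Fin n → Option Bool) :
    nfix (Fin.cons none c : Fin (n+1) → Option Bool) = nfix c := by
  simp [nfix, Fin.card_filter_univ_succ]

lemma nfix_some {n : ℕ} (a : Bool) (c : Fin n → Option Bool) :
    nfix (Fin.cons (some a) c : Fin (n+1) → Option Bool) = nfix c + 1 := by
  simp [nfix, Fin.card_filter_univ_succ]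

open Classical in
lemma card_total (n : ℕ) : ∀ k : ℕ,
    (univ.filter fun c : Fin n → Option Bool => nfix c = k).card = 2 ^ k * n.choose k := by
  induction n with
  | zero =>
    intro k
    cases k with
    | zero => simp [nfix]
    | succ k => simp [nfix]
  | succ n ih =>
    intro k
    rw [card_split]
    simp only [nfix_none, nfix_some]
    cases k with
    | zero => simp [ih]
    | succ k =>
      simp only [add_left_inj, ih, Nat.choose_succ_succ]
      ring

lemma can_some {n : ℕ} (f : (Fin (n+1) → Bool) → Bool) (a : Bool) (c : Fin n → Option Bool) :
    CanalizesOn f (Fin.cons (some a) c) ↔ CanalizesOn (fun x => f (Fin.cons a x)) c := by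
  constructor
  · rintro ⟨b, h⟩
    refine ⟨b, fun x hx => h _ ?_⟩
    intro i
    refine Fin.cases ?_ (fun j => ?_) i
    · simp
    · simpa using hx j
  · rintro ⟨b, h⟩
    refine ⟨b, fun x hx => ?_⟩
    have h0 : x 0 = a := hx 0 a (by simp)
    have := h (Fin.tail x) (fun i a' hi => hx i.succ a' (by simpa using hi))
    rw [← h0] at this
    simpa using this

lemma can_none {n : ℕ} (f : (Fin (n+1) → Bool) → Bool) (c : Fin n → Option Bool)
    (h : CanalizesOn f (Fin.cons none c)) :
    ∃ b, ∀ (a : Bool) (x : Fin n → Bool), (∀ i a, c i = some a → x i = a) →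
      f (Fin.cons a x) = b := by
  obtain ⟨b, h⟩ := h
  refine ⟨b, fun a x hx => h _ ?_⟩
  intro i
  refine Fin.cases ?_ (fun j => ?_) i
  · simp
  · simpa using hx j

open Classical in
/-- number of non-canalizing k-sets -/
noncomputable def nonCan {n : ℕ} (f : (Fin n → Bool) → Bool) (k : ℕ) : ℕ :=
  (univ.filter fun c : Fin n → Option Bool => nfix c = k ∧ ¬ CanalizesOn f c).card

lemma choose_bound (n k : ℕ) (hk : k ≤ n) : (n+1).choose k ≤ 2 ^ k * n.choose k := by
  have h := Nat.choose_mul_succ_eq n k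
  have h1 : k + 1 ≤ 2 ^ k := Nat.lt_two_pow_self
  obtain ⟨d, rfl⟩ := Nat.exists_eq_add_of_le hk
  have e : k + d + 1 - k = d + 1 := by omega
  rw [e] at h
  refine le_trans ?_ (Nat.mul_le_mul_right _ h1)
  refine Nat.le_of_mul_le_mul_right (c := d + 1) ?_ (by omega)
  rw [← h]
  nlinarith [Nat.zero_le ((k+d).choose k * (k * d))]

open Classical in
lemma main_bound (n : ℕ) : ∀ (f : (Fin n → Bool) → Bool)
    (_ : ¬ ∃ b : Bool, ∀ x : Fin n → Bool, f x = b) (k : ℕ) (_ : k < n),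
    n.choose k ≤ nonCan f k := by
  induction n with
  | zero => intro f hf k hk; omega
  | succ n ih =>
    intro f hf k hk
    cases k with
    | zero =>
      simp only [Nat.choose_zero_right, nonCan]
      refine Finset.card_pos.mpr ⟨fun _ => none, ?_⟩
      simp only [mem_filter, mem_univ, true_and]
      refine ⟨by simp [nfix], ?_⟩
      rintro ⟨b, h⟩
      exact hf ⟨b, fun x => h x (by simp)⟩
    | succ k =>
      have hsplit : nonCan f (k+1) =
          (univ.filter fun c : Fin n → Option Bool =>
            nfix c = k + 1 ∧ ¬ CanalizesOn f (Fin.cons none c)).card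
          + nonCan (fun x => f (Fin.cons true x)) k
          + nonCan (fun x => f (Fin.cons false x)) k := by
        unfold nonCan
        rw [card_split]
        simp only [nfix_none, nfix_some, can_some, add_left_inj]
      rw [hsplit]
      have hF : ∀ a, nonCan (fun x => f (Fin.cons a x)) (k+1) ≤
          (univ.filter fun c : Fin n → Option Bool =>
            nfix c = k + 1 ∧ ¬ CanalizesOn f (Fin.cons none c)).card := by
        intro a
        refine Finset.card_le_card ?_
        intro c
        simp only [mem_filter, mem_univ, true_and]
        rintro ⟨h1, h2⟩
        refine ⟨h1, fun h => h2 ?_⟩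
        obtain ⟨b, hb⟩ := can_none f c h
        exact ⟨b, hb a⟩
      have hE : k + 1 = n → (∃ x : Fin n → Bool, f (Fin.cons true x) ≠ f (Fin.cons false x)) →
          1 ≤ (univ.filter fun c : Fin n → Option Bool =>
            nfix c = k + 1 ∧ ¬ CanalizesOn f (Fin.cons none c)).card := by
        rintro hkn ⟨x, hx⟩
        refine Finset.card_pos.mpr ⟨fun i => some (x i), ?_⟩
        simp only [mem_filter, mem_univ, true_and]
        refine ⟨by simp [nfix, hkn], fun h => hx ?_⟩
        obtain ⟨b, hb⟩ := can_none f _ h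
        rw [hb true x (by simp), hb false x (by simp)]
      have hcs := Nat.choose_succ_succ n k
      simp only [Nat.succ_eq_add_one] at hcs
      have mixed : ∀ a, (¬ ∃ b : Bool, ∀ x : Fin n → Bool, f (Fin.cons a x) = b) →
          (∃ b : Bool, ∀ x : Fin n → Bool, f (Fin.cons (!a) x) = b) →
          n.choose (k+1) ≤ (univ.filter fun c : Fin n → Option Bool =>
            nfix c = k + 1 ∧ ¬ CanalizesOn f (Fin.cons none c)).card := by
        rintro a ha ⟨b, hb⟩
        by_cases hkn : k + 1 = n
        · have := hE hkn (by
            by_contra! hcon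
            refine ha ⟨b, fun x => ?_⟩
            have h1 := hcon x
            have h2 := hb x
            cases a
            · exact h1.symm.trans h2
            · exact h1.trans h2)
          have h3 : n.choose (k+1) = 1 := by rw [hkn, Nat.choose_self]
          rw [h3]
          exact this
        · exact (ih _ ha (k+1) (by omega)).trans (hF a)
      by_cases ht : ∃ b : Bool, ∀ x : Fin n → Bool, f (Fin.cons true x) = b
      · by_cases hff : ∃ b : Bool, ∀ x : Fin n → Bool, f (Fin.cons false x) = b
        · obtain ⟨b, hb⟩ := ht
          obtain ⟨b', hb'⟩ := hff
          have hne : b ≠ b' := by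
            rintro rfl
            refine hf ⟨b, fun x => ?_⟩
            rw [← Fin.cons_self_tail x]
            cases x 0
            · exact hb' _
            · exact hb _
          have hall : (univ.filter fun c : Fin n → Option Bool =>
              nfix c = k + 1 ∧ ¬ CanalizesOn f (Fin.cons none c)) =
              univ.filter fun c : Fin n → Option Bool => nfix c = k + 1 := by
            ext c
            simp only [mem_filter, mem_univ, true_and, and_iff_left_iff_imp]
            intro _ h
            obtain ⟨d, hd⟩ := can_none f c h
            have hx : ∀ i a, c i = some a → (fun i => (c i).getD true) i = a := by
              intro i a h; simp [h]
            apply hne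
            rw [← hb (fun i => (c i).getD true), ← hb' (fun i => (c i).getD true),
              hd true _ hx, hd false _ hx]
          rw [hall, card_total]
          have := choose_bound n (k+1) (by omega)
          omega
        · have h1 := ih _ hff k (by omega)
          have h2 := mixed false hff (by simpa using ht)
          omega
      · have h1 := ih _ ht k (by omega)
        by_cases hff : ∃ b : Bool, ∀ x : Fin n → Bool, f (Fin.cons false x) = b
        · have h2 := mixed true ht (by simpa using hff)
          omega
        · have h2 := ih _ hff k (by omega)
          by_cases hkn : k + 1 = n
          · subst hkn
            simp only [Nat.choose_self, Nat.choose_succ_self_right] at *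
            omega
          · have h3 := (ih _ ht (k+1) (by omega)).trans (hF true)
            omega

theorem Pk_le_of_nonconstant (n : ℕ) (f : (Fin n → Bool) → Bool)
    (hf : ¬ ∃ b : Bool, ∀ x : Fin n → Bool, f x = b)
    (k : ℕ) (hk : k < n) :
    canalizingProportion n f k ≤ 1 - 1 / 2 ^ k := by
  classical
  have h1 := main_bound n f hf k hk
  have h2 := card_total n k
  have h3 : Nat.card {c : Fin n → Option Bool //
      (Finset.univ.filter fun i => (c i).isSome).card = k ∧ CanalizesOn f c} + nonCan f k
      = 2 ^ k * n.choose k := by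
    rw [← h2, ← Finset.card_filter_add_card_filter_not (fun c => CanalizesOn f c),
      Finset.filter_filter, Finset.filter_filter, Nat.card_eq_fintype_card, Fintype.card_subtype]
    unfold nonCan nfix
    congr!
  unfold canalizingProportion
  have hc : (0:ℝ) < n.choose k := by exact_mod_cast Nat.choose_pos hk.le
  have h3' : ((Nat.card {c : Fin n → Option Bool //
      (Finset.univ.filter fun i => (c i).isSome).card = k ∧ CanalizesOn f c} : ℕ) : ℝ)
      + (nonCan f k : ℝ) = 2 ^ k * n.choose k := by exact_mod_cast h3
  have h1' : (n.choose k : ℝ) ≤ nonCan f k := by exact_mod_cast h1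
  rw [div_le_iff₀ (by positivity)]
  have e : (1 - 1 / 2 ^ k : ℝ) * (2 ^ k * n.choose k) = 2 ^ k * n.choose k - n.choose k := by
    field_simp
  rw [e]
  linarith
end

section
/- Let f : {0,1}^n → {0,1} be a nested canalizing function with exactly one layer, i.e., there exist b, α_1, …, α_n ∈ {0,1} such that f(x_1,…,x_n) = b ⊕ ∏_{i=1}^n (x_i ⊕ α_i), where ⊕ denotes addition modulo 2 and the product is taken in the field with two elements. Then P_k(f) = 1 − 1/2^k for all 0 ≤ k < n. -/
open Finset

/-- `f` is a nested canalizing function with exactly one layer: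
f(x) = b ⊕ ∏ i, (x i ⊕ α i), where the product over 𝔽₂ equals 1 iff x i ≠ α i for all i. -/
def NCFOneLayer {n : ℕ} (f : (Fin n → Bool) → Bool) : Prop :=
  ∃ (b : Bool) (α : Fin n → Bool),
    ∀ x : Fin n → Bool, f x = xor b (decide (∀ i : Fin n, x i ≠ α i))

lemma count_aux (n k m : ℕ) (g : Fin n → Finset Bool) (hg : ∀ i, (g i).card = m) :
    (Finset.univ.filter fun c : Fin n → Option Bool =>
      (Finset.univ.filter fun i => (c i).isSome).card = k ∧
        ∀ i a, c i = some a → a ∈ g i).card = m ^ k * n.choose k := by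
  classical
  rw [Finset.card_eq_sum_card_fiberwise
    (f := fun c : Fin n → Option Bool => Finset.univ.filter fun i => (c i).isSome)
    (t := Finset.powersetCard k (Finset.univ : Finset (Fin n)))]
  · have : ∀ S ∈ Finset.powersetCard k (Finset.univ : Finset (Fin n)),
        (Finset.filter (fun c : Fin n → Option Bool =>
            (Finset.univ.filter fun i => (c i).isSome) = S)
          (Finset.univ.filter fun c : Fin n → Option Bool =>
            (Finset.univ.filter fun i => (c i).isSome).card = k ∧
            ∀ i a, c i = some a → a ∈ g i)).card = m ^ k := by
      intro S hS
      have hSk := (Finset.mem_powersetCard.1 hS).2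
      have : (Finset.filter (fun c : Fin n → Option Bool =>
            (Finset.univ.filter fun i => (c i).isSome) = S)
          (Finset.univ.filter fun c : Fin n → Option Bool =>
            (Finset.univ.filter fun i => (c i).isSome).card = k ∧
            ∀ i a, c i = some a → a ∈ g i)) =
          Fintype.piFinset (fun i => if i ∈ S then (g i).map Function.Embedding.some
            else {none}) := by
        ext c
        simp only [Finset.mem_filter, Finset.mem_univ, true_and, Fintype.mem_piFinset]
        constructor
        · rintro ⟨⟨_, h⟩, rfl⟩ i
          rcases hc : c i with _ | a
          · simp [hc]
          · simpa [hc] using h i a hc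
        · intro h
          have hs : (Finset.univ.filter fun i => (c i).isSome) = S := by
            ext i
            have hi := h i
            by_cases hiS : i ∈ S
            · simp only [hiS, if_true, Finset.mem_map] at hi
              obtain ⟨a, _, ha⟩ := hi
              simp [hiS, ← ha]
            · simp only [hiS, if_false, Finset.mem_singleton] at hi
              simp [hiS, hi]
          refine ⟨⟨by rw [hs, hSk], ?_⟩, hs⟩
          intro i a hia
          have hi := h i
          by_cases hiS : i ∈ S
          · simpa [hiS, hia] using hi
          · simp [hiS, hia] at hi
      rw [this, Fintype.card_piFinset]
      have h2 : ∀ i, (if i ∈ S then (g i).map Function.Embedding.some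
            else ({none} : Finset (Option Bool))).card = if i ∈ S then m else 1 := by
        intro i
        split_ifs <;> simp [hg]
      simp only [h2]
      rw [Finset.prod_ite_mem]
      simp [hSk]
    rw [Finset.sum_congr rfl this]
    simp [mul_comm]
  · intro c hc
    simp only [Finset.coe_filter, Finset.mem_univ, true_and, Set.mem_ofPred_eq] at hc
    simp [Finset.mem_powersetCard, hc.1]

lemma canalizes_iff {n : ℕ} (f : (Fin n → Bool) → Bool) (b : Bool) (α : Fin n → Bool)
    (hf : ∀ x : Fin n → Bool, f x = xor b (decide (∀ i : Fin n, x i ≠ α i)))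
    (c : Fin n → Option Bool)
    (hc : (Finset.univ.filter fun i => (c i).isSome).card < n) :
    CanalizesOn f c ↔ ¬ ∀ i a, c i = some a → a ∈ ({!α i} : Finset Bool) := by
  constructor
  · rintro ⟨v, hv⟩ h
    obtain ⟨j, hj⟩ : ∃ j, c j = none := by
      by_contra hne
      push Not at hne
      have : (Finset.univ.filter fun i => (c i).isSome) = Finset.univ := by
        ext i
        simp [Option.isSome_iff_ne_none, hne i]
      rw [this] at hc
      simp at hc
    have h1 := hv (fun i => !α i) (fun i a hia => by simpa using (Finset.mem_singleton.1 (h i a hia)).symm)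
    have h2 := hv (Function.update (fun i => !α i) j (α j)) (fun i a hia => by
      have hij : i ≠ j := by rintro rfl; simp [hj] at hia
      simpa [hij] using (Finset.mem_singleton.1 (h i a hia)).symm)
    rw [hf] at h1 h2
    have e1 : ∀ i, (fun i => !α i) i ≠ α i := by simp
    have e2 : ¬ ∀ i, Function.update (fun i => !α i) j (α j) i ≠ α i := by
      intro h; exact h j (by simp)
    rw [decide_eq_true e1] at h1
    rw [decide_eq_false e2] at h2
    rw [← h2] at h1
    cases b <;> simp at h1
  · intro h
    push Not at h
    obtain ⟨i, a, hia, ha⟩ := h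
    refine ⟨b, fun x hx => ?_⟩
    have hxi := hx i a hia
    have : ¬ ∀ i, x i ≠ α i := by
      intro h
      apply ha
      have := h i
      rw [hxi] at this
      rw [Finset.mem_singleton]
      revert this
      cases a <;> cases α i <;> simp
    rw [hf, decide_eq_false this]
    simp

theorem Pk_of_NCFOneLayer (n : ℕ) (f : (Fin n → Bool) → Bool)
    (hf : NCFOneLayer f) (k : ℕ) (hk : k < n) :
    canalizingProportion n f k = 1 - 1 / 2 ^ k := by
  classical
  obtain ⟨b, α, hf⟩ := hf
  have hA := count_aux n k 2 (fun _ => Finset.univ) (by simp)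
  have hB := count_aux n k 1 (fun i => {!α i}) (by simp)
  simp only [Finset.mem_univ, implies_true, and_true] at hA
  have hsum := Finset.card_filter_add_card_filter_not
    (s := Finset.univ.filter fun c : Fin n → Option Bool =>
      (Finset.univ.filter fun i => (c i).isSome).card = k)
    (fun c => ∀ i a, c i = some a → a ∈ ({!α i} : Finset Bool))
  rw [Finset.filter_filter, Finset.filter_filter, hA, hB] at hsum
  have hC : Nat.card {c : Fin n → Option Bool //
      (Finset.univ.filter fun i => (c i).isSome).card = k ∧ CanalizesOn f c} =
      (Finset.univ.filter fun c : Fin n → Option Bool =>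
        (Finset.univ.filter fun i => (c i).isSome).card = k ∧
        ¬ ∀ i a, c i = some a → a ∈ ({!α i} : Finset Bool)).card := by
    rw [Nat.card_eq_fintype_card, Fintype.card_subtype]
    congr 1
    apply Finset.filter_congr
    intro c _
    refine and_congr_right fun h => canalizes_iff f b α hf c (by omega)
  unfold canalizingProportion
  rw [hC]
  have hpos : (0 : ℝ) < n.choose k := by exact_mod_cast Nat.choose_pos hk.le
  have hs : (1 : ℝ) ^ k * n.choose k + ((Finset.univ.filter fun c : Fin n → Option Bool =>
        (Finset.univ.filter fun i => (c i).isSome).card = k ∧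
        ¬ ∀ i a, c i = some a → a ∈ ({!α i} : Finset Bool)).card : ℝ) =
        2 ^ k * n.choose k := by exact_mod_cast hsum
  rw [eq_sub_of_add_eq' hs]
  field_simp
  simp
end

section
/- Fix a bias p ∈ (0,1) and let f : {0,1}^n → {0,1} be a p-biased random Boolean function. Then for every 0 ≤ k ≤ n, the expected k-set canalizing proportion satisfies E[P_k(f)] = (1−p)^{2^{n−k}} + p^{2^{n−k}}. -/
open Finset

/-- The probability weight of the Boolean function `f` under the p-biased product
measure: each output value is independently 1 with probability `p`. -/
noncomputable def biasedWeight (n : ℕ) (p : ℝ) (f : (Fin n → Bool) → Bool) : ℝ :=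
  ∏ x : Fin n → Bool, (if f x then p else 1 - p)

/-- Inputs compatible with a partial assignment. -/
def compatSet {n : ℕ} (c : Fin n → Option Bool) : Finset (Fin n → Bool) :=
  Fintype.piFinset fun i => match c i with
    | some a => {a}
    | none => Finset.univ

lemma mem_compatSet {n : ℕ} (c : Fin n → Option Bool) (x : Fin n → Bool) :
    x ∈ compatSet c ↔ ∀ i : Fin n, ∀ a : Bool, c i = some a → x i = a := by
  unfold compatSet
  rw [Fintype.mem_piFinset]
  refine forall_congr' fun i => ?_
  cases h : c i with
  | none => simp
  | some a => simp

lemma card_compatSet {n : ℕ} (c : Fin n → Option Bool) :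
    (compatSet c).card = 2 ^ (n - (Finset.univ.filter fun i => (c i).isSome).card) := by
  unfold compatSet
  rw [Fintype.card_piFinset]
  have h : ∀ i, (match c i with
      | some a => ({a} : Finset Bool)
      | none => Finset.univ).card = if (c i).isSome then 1 else 2 := by
    intro i
    cases h : c i <;> simp
  rw [Finset.prod_congr rfl (fun i _ => h i), Finset.prod_ite]
  have h2 := Finset.card_filter_add_card_filter_not (s := (Finset.univ : Finset (Fin n)))
    (fun i => ((c i).isSome = true))
  rw [Finset.card_univ, Fintype.card_fin] at h2
  simp only [Finset.prod_const, one_pow, one_mul]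
  congr 1
  omega

lemma card_partial (n k : ℕ) :
    (Finset.univ.filter fun c : Fin n → Option Bool =>
      (Finset.univ.filter fun i => (c i).isSome).card = k).card = 2 ^ k * n.choose k := by
  rw [Finset.card_eq_sum_card_fiberwise
    (f := fun c : Fin n → Option Bool => Finset.univ.filter fun i => (c i).isSome)
    (t := Finset.powersetCard k Finset.univ)]
  · have : ∀ S ∈ Finset.powersetCard k (Finset.univ : Finset (Fin n)),
        ((Finset.univ.filter fun c : Fin n → Option Bool =>
          (Finset.univ.filter fun i => (c i).isSome).card = k).filter
            fun c => (Finset.univ.filter fun i => (c i).isSome) = S).card = 2 ^ k := by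
      intro S hS
      rw [Finset.mem_powersetCard] at hS
      have e : ((Finset.univ.filter fun c : Fin n → Option Bool =>
          (Finset.univ.filter fun i => (c i).isSome).card = k).filter
            fun c => (Finset.univ.filter fun i => (c i).isSome) = S) =
          Fintype.piFinset fun i => if i ∈ S then ({some true, some false} : Finset (Option Bool))
            else {none} := by
        ext c
        rw [Fintype.mem_piFinset, Finset.mem_filter, Finset.mem_filter]
        constructor
        · rintro ⟨_, h⟩ i
          have := Finset.ext_iff.1 h i
          rw [Finset.mem_filter] at this
          clear h
          rcases hc : c i with _ | _ | _ <;> by_cases hi : i ∈ S <;> simp_all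
        · intro h
          have h2 : (Finset.univ.filter fun i => (c i).isSome) = S := by
            ext i
            have := h i
            rcases hc : c i with _ | _ | _ <;> by_cases hi : i ∈ S <;> simp_all
          exact ⟨⟨Finset.mem_univ _, by rw [h2]; exact hS.2⟩, h2⟩
      rw [e, Fintype.card_piFinset]
      have : ∀ i, (if i ∈ S then ({some true, some false} : Finset (Option Bool))
            else {none}).card = if i ∈ S then 2 else 1 := by
        intro i; split_ifs <;> rfl
      rw [Finset.prod_congr rfl (fun i _ => this i), Finset.prod_ite_mem]
      simp [hS.2]
    rw [Finset.sum_congr rfl this]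
    simp [mul_comm]
  · intro c hc
    simp only [Finset.coe_filter, Finset.mem_univ, true_and, Set.mem_ofPred_eq] at hc
    simp [hc]

open Classical in
lemma sum_const_on (n : ℕ) (p : ℝ) (S : Finset (Fin n → Bool)) (b : Bool) :
    ∑ f : (Fin n → Bool) → Bool, biasedWeight n p f * (if ∀ x ∈ S, f x = b then 1 else 0)
      = (if b then p else 1 - p) ^ S.card := by
  have h : ∀ f : (Fin n → Bool) → Bool,
      biasedWeight n p f * (if ∀ x ∈ S, f x = b then 1 else 0) =
      ∏ x, ((if f x then p else 1 - p) * (if x ∈ S → f x = b then 1 else 0)) := by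
    intro f
    rw [Finset.prod_mul_distrib, Finset.prod_ite_zero]
    simp [biasedWeight]
  rw [Finset.sum_congr rfl (fun f _ => h f), ← Fintype.piFinset_univ,
    ← Finset.prod_univ_sum (fun _ => Finset.univ)
      (fun x v => ((if v then p else 1 - p) * (if x ∈ S → v = b then 1 else 0)))]
  have h2 : ∀ x, (∑ v : Bool, ((if v then p else 1 - p) * (if x ∈ S → v = b then (1:ℝ) else 0)))
      = if x ∈ S then (if b then p else 1 - p) else 1 := by
    intro x
    by_cases hx : x ∈ S <;> cases b <;> simp [hx]
  rw [Finset.prod_congr rfl (fun x _ => h2 x), Finset.prod_ite_mem]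
  simp

open Classical in
lemma sum_canalizes (n : ℕ) (p : ℝ) (c : Fin n → Option Bool) :
    ∑ f : (Fin n → Bool) → Bool, biasedWeight n p f * (if CanalizesOn f c then 1 else 0)
      = (1 - p) ^ (compatSet c).card + p ^ (compatSet c).card := by
  have hne : (compatSet c).Nonempty := by
    rw [← Finset.card_pos, card_compatSet]; positivity
  obtain ⟨y, hy⟩ := hne
  have h : ∀ f : (Fin n → Bool) → Bool, (if CanalizesOn f c then (1:ℝ) else 0) =
      (if ∀ x ∈ compatSet c, f x = false then 1 else 0) +
      (if ∀ x ∈ compatSet c, f x = true then 1 else 0) := by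
    intro f
    have e : CanalizesOn f c ↔
        (∀ x ∈ compatSet c, f x = false) ∨ (∀ x ∈ compatSet c, f x = true) := by
      simp only [CanalizesOn, mem_compatSet, Bool.exists_bool]
    by_cases h1 : ∀ x ∈ compatSet c, f x = false
    · have h2 : ¬ ∀ x ∈ compatSet c, f x = true := by
        intro h2
        have a1 := h1 y hy
        have a2 := h2 y hy
        simp_all
      rw [if_pos (e.2 (Or.inl h1)), if_pos h1, if_neg h2, add_zero]
    · by_cases h2 : ∀ x ∈ compatSet c, f x = true
      · rw [if_pos (e.2 (Or.inr h2)), if_neg h1, if_pos h2, zero_add]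
      · rw [if_neg (fun h => (e.1 h).elim h1 h2), if_neg h1, if_neg h2, add_zero]
  simp only [h, mul_add, Finset.sum_add_distrib]
  rw [sum_const_on, sum_const_on]
  simp

theorem expected_Pk_biased (p : ℝ) (hp0 : 0 < p) (hp1 : p < 1)
    (n k : ℕ) (hk : k ≤ n) :
    ∑ f : (Fin n → Bool) → Bool, biasedWeight n p f * canalizingProportion n f k
      = (1 - p) ^ (2 ^ (n - k)) + p ^ (2 ^ (n - k)) := by
  classical
  set T := Finset.univ.filter fun c : Fin n → Option Bool =>
      (Finset.univ.filter fun i => (c i).isSome).card = k with hT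
  have h : ∀ f : (Fin n → Bool) → Bool, biasedWeight n p f * canalizingProportion n f k =
      (∑ c ∈ T, biasedWeight n p f * (if CanalizesOn f c then 1 else 0)) /
        (2 ^ k * (n.choose k) : ℝ) := by
    intro f
    unfold canalizingProportion
    rw [Nat.card_eq_fintype_card, Fintype.card_subtype, ← Finset.filter_filter, ← Finset.mul_sum,
      Finset.sum_boole, mul_div_assoc]
  rw [Finset.sum_congr rfl (fun f _ => h f), ← Finset.sum_div, Finset.sum_comm]
  have h2 : ∀ c ∈ T, ∑ f : (Fin n → Bool) → Bool,
      biasedWeight n p f * (if CanalizesOn f c then 1 else 0) =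
      (1 - p) ^ (2 ^ (n - k)) + p ^ (2 ^ (n - k)) := by
    intro c hc
    rw [hT, Finset.mem_filter] at hc
    rw [sum_canalizes, card_compatSet, hc.2]
  rw [Finset.sum_congr rfl h2, Finset.sum_const, hT, card_partial, nsmul_eq_mul]
  have : (0:ℝ) < n.choose k := by exact_mod_cast Nat.choose_pos hk
  push_cast
  field_simp
end

section
/- Fix a bias p ∈ (0,1) and a positive integer k. Then the probability that a p-biased random Boolean function f on n variables satisfies P_k(f) > 0 tends to 0 as n → ∞: lim_{n→∞} P(P_k(f) > 0) = 0. -/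
open Finset

/-- Total weight of the functions that are constantly `b` on `S`. -/
lemma sum_weight_const {n : ℕ} (p : ℝ) (S : Finset (Fin n → Bool)) (b : Bool) :
    ∑ f ∈ Fintype.piFinset (fun x => if x ∈ S then ({b} : Finset Bool) else Finset.univ),
      biasedWeight n p f = (if b then p else 1 - p) ^ S.card := by
  unfold biasedWeight
  rw [← Finset.prod_univ_sum (fun x => if x ∈ S then ({b} : Finset Bool) else Finset.univ)
    (fun _ y => if y then p else 1 - p)]
  rw [← Finset.prod_const, ← Finset.prod_subset (Finset.subset_univ S)]
  · refine Finset.prod_congr rfl fun x hx => ?_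
    simp [hx]
  · intro x _ hx
    simp [hx]

/-- The subcube of inputs that agree with `c`. -/
def cube {n : ℕ} (c : Fin n → Option Bool) : Finset (Fin n → Bool) :=
  Fintype.piFinset fun i => (c i).elim Finset.univ (fun a => {a})

lemma mem_cube {n : ℕ} (c : Fin n → Option Bool) (x : Fin n → Bool) :
    x ∈ cube c ↔ ∀ i : Fin n, ∀ a : Bool, c i = some a → x i = a := by
  unfold cube
  rw [Fintype.mem_piFinset]
  refine forall_congr' fun i => ?_
  cases h : c i with
  | none => simp
  | some v => simp

lemma card_cube {n k : ℕ} (c : Fin n → Option Bool)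
    (hc : (Finset.univ.filter fun i => (c i).isSome).card = k) :
    (cube c).card = 2 ^ (n - k) := by
  unfold cube
  rw [Fintype.card_piFinset]
  have h1 : ∀ i : Fin n, ((c i).elim Finset.univ (fun a => ({a} : Finset Bool))).card
      = if (c i).isSome then 1 else 2 := by
    intro i
    cases h : c i <;> simp
  rw [Finset.prod_congr rfl fun i _ => h1 i, Finset.prod_ite]
  simp only [Finset.prod_const, one_pow, one_mul]
  congr 1
  have := Finset.card_filter_add_card_filter_not (s := (Finset.univ : Finset (Fin n)))
    (fun i => (c i).isSome = true)
  simp only [Finset.card_univ, Fintype.card_fin] at this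
  omega

lemma weight_nonneg {n : ℕ} {p : ℝ} (hp0 : 0 < p) (hp1 : p < 1) (f : (Fin n → Bool) → Bool) :
    0 ≤ biasedWeight n p f := by
  unfold biasedWeight
  refine Finset.prod_nonneg fun x _ => ?_
  split_ifs <;> linarith

lemma sum_biUnion_le_sum {ι α : Type*} [DecidableEq ι] [DecidableEq α] (s : Finset ι)
    (A : ι → Finset α) (w : α → ℝ) (hw : ∀ a, 0 ≤ w a) :
    ∑ a ∈ s.biUnion A, w a ≤ ∑ i ∈ s, ∑ a ∈ A i, w a := by
  induction s using Finset.induction_on with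
  | empty => simp
  | insert i s hi ih =>
    rw [Finset.biUnion_insert, Finset.sum_insert hi]
    have h1 := Finset.sum_union_inter (s₁ := A i) (s₂ := s.biUnion A) (f := w)
    have h2 : 0 ≤ ∑ a ∈ A i ∩ s.biUnion A, w a := Finset.sum_nonneg fun a _ => hw a
    linarith

open Classical in
lemma prob_bound (n k : ℕ) (p : ℝ) (hp0 : 0 < p) (hp1 : p < 1) :
    ∑ f : (Fin n → Bool) → Bool,
          (if 0 < canalizingProportion n f k then biasedWeight n p f else 0)
      ≤ 3 ^ n * 2 * (max p (1 - p)) ^ (2 ^ (n - k)) := by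
  let T := Finset.univ.filter fun c : Fin n → Option Bool =>
    (Finset.univ.filter fun i => (c i).isSome).card = k
  let A : (Fin n → Option Bool) × Bool → Finset ((Fin n → Bool) → Bool) := fun cb =>
    Fintype.piFinset (fun x => if x ∈ cube cb.1 then ({cb.2} : Finset Bool) else Finset.univ)
  have hsub : (Finset.univ.filter fun f => 0 < canalizingProportion n f k) ⊆
      (T ×ˢ Finset.univ).biUnion A := by
    intro f hf
    simp only [Finset.mem_filter, Finset.mem_univ, true_and] at hf
    have hne : Nat.card {c : Fin n → Option Bool //
      (Finset.univ.filter fun i => (c i).isSome).card = k ∧ CanalizesOn f c} ≠ 0 := by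
      intro h0
      unfold canalizingProportion at hf
      rw [h0] at hf
      simp at hf
    have hne2 := (Nat.card_pos_iff.mp (Nat.pos_of_ne_zero hne)).1
    obtain ⟨c, hc, b, hb⟩ := hne2
    refine Finset.mem_biUnion.mpr ⟨(c, b), by simp [T, hc], ?_⟩
    simp only [A, Fintype.mem_piFinset]
    intro x
    split_ifs with hx
    · simpa using hb x ((mem_cube c x).mp hx)
    · simp
  rw [← Finset.sum_filter]
  have hq : ∀ b : Bool, (if b then p else 1 - p) ≤ max p (1 - p) := by
    intro b; cases b <;> simp
  have hq0 : ∀ b : Bool, 0 ≤ (if b then p else 1 - p) := by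
    intro b; split_ifs <;> linarith
  calc _ ≤ ∑ f ∈ (T ×ˢ Finset.univ).biUnion A, biasedWeight n p f :=
        Finset.sum_le_sum_of_subset_of_nonneg hsub fun f _ _ => weight_nonneg hp0 hp1 f
    _ ≤ ∑ cb ∈ T ×ˢ Finset.univ, ∑ f ∈ A cb, biasedWeight n p f := by
        exact sum_biUnion_le_sum _ A _ (weight_nonneg hp0 hp1)
    _ ≤ ∑ cb ∈ T ×ˢ (Finset.univ : Finset Bool), (max p (1 - p)) ^ (2 ^ (n - k)) := by
        refine Finset.sum_le_sum fun cb hcb => ?_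
        have hc : (Finset.univ.filter fun i => (cb.1 i).isSome).card = k := by
          simpa [T] using hcb
        simp only [A]
        rw [sum_weight_const, card_cube cb.1 hc]
        exact pow_le_pow_left₀ (hq0 _) (hq _) _
    _ ≤ _ := by
        rw [Finset.sum_const, nsmul_eq_mul]
        refine mul_le_mul_of_nonneg_right ?_ (by positivity)
        have hT : T.card ≤ 3 ^ n := by
          refine (Finset.card_le_univ T).trans ?_
          simp
        rw [Finset.card_product]
        simp only [Finset.card_univ, Fintype.card_bool, Nat.cast_mul, Nat.cast_ofNat]
        have : (T.card : ℝ) ≤ 3 ^ n := by exact_mod_cast hT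
        linarith

open Filter in
lemma bound_tendsto (k : ℕ) (q : ℝ) (hq0 : 0 < q) (hq1 : q < 1) :
    Tendsto (fun n : ℕ => 3 ^ n * 2 * q ^ (2 ^ (n - k))) atTop (nhds 0) := by
  rw [← tendsto_add_atTop_iff_nat k]
  have h1 := (tendsto_pow_const_mul_const_pow_of_abs_lt_one 2
    (r := q) (by rwa [abs_of_pos hq0])).comp
    (tendsto_pow_atTop_atTop_of_one_lt (r := 2) (by norm_num : (1:ℕ) < 2))
  have h2 := h1.const_mul (3 ^ k * 2 : ℝ)
  rw [mul_zero] at h2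
  refine squeeze_zero (fun m => by positivity) (fun m => ?_) h2
  simp only [Function.comp_apply, Nat.add_sub_cancel, Nat.cast_pow, Nat.cast_ofNat]
  have h3 : (3:ℝ) ^ m ≤ (2 ^ m) ^ 2 := by
    rw [← pow_mul, mul_comm, pow_mul]
    exact pow_le_pow_left₀ (by norm_num) (by norm_num) _
  calc (3:ℝ) ^ (m + k) * 2 * q ^ 2 ^ m = 3 ^ k * 2 * (3 ^ m * q ^ 2 ^ m) := by ring
    _ ≤ _ := by gcongr

open Filter Classical in
theorem prob_Pk_pos_tendsto_zero (p : ℝ) (hp0 : 0 < p) (hp1 : p < 1) (k : ℕ) (hk : 0 < k) :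
    Tendsto
      (fun n : ℕ =>
        ∑ f : (Fin n → Bool) → Bool,
          (if 0 < canalizingProportion n f k then biasedWeight n p f else 0))
      atTop (nhds 0) := by
  refine squeeze_zero (fun n => ?_) (fun n => prob_bound n k p hp0 hp1)
    (bound_tendsto k (max p (1 - p)) (lt_max_of_lt_left hp0) (max_lt hp1 (by linarith)))
  refine Finset.sum_nonneg fun f _ => ?_
  split_ifs
  · exact weight_nonneg hp0 hp1 f
  · exact le_rfl
end

section
/- Let f : {0,1}^n → {0,1} be a Boolean function and let 0 < k ≤ n. Then the normalized average sensitivity satisfies s(f) ≥ (1/2^{k−1})·(1 − P_{n−k}(f)). -/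
open Finset

/-- The normalized average sensitivity of a Boolean function. -/
noncomputable def normAvgSensitivity (n : ℕ) (f : (Fin n → Bool) → Bool) : ℝ :=
  (1 / ((n : ℝ) * 2 ^ n)) * ∑ x : Fin n → Bool, ∑ i : Fin n,
    (if f x ≠ f (Function.update x i (!(x i))) then (1 : ℝ) else 0)



namespace SensLB

/-- the support of a partial assignment -/
def supp {n : ℕ} (c : Fin n → Option Bool) : Finset (Fin n) :=
  Finset.univ.filter fun i => (c i).isSome

open Classical in
/-- non-canalizing m-sets -/
noncomputable def Q {n : ℕ} (f : (Fin n → Bool) → Bool) (m : ℕ) :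
    Finset (Fin n → Option Bool) :=
  Finset.univ.filter fun c => (supp c).card = m ∧ ¬ CanalizesOn f c

lemma card_total (n m : ℕ) :
    (Finset.univ.filter fun c : Fin n → Option Bool => (supp c).card = m).card
      = 2 ^ m * n.choose m := by
  classical
  rw [Finset.card_eq_sum_card_fiberwise (f := supp)
    (t := Finset.powersetCard m (Finset.univ : Finset (Fin n)))]
  · have key : ∀ S ∈ Finset.powersetCard m (Finset.univ : Finset (Fin n)),
        ((Finset.univ.filter fun c : Fin n → Option Bool => (supp c).card = m).filter
          fun c => supp c = S).card = 2 ^ m := by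
      intro S hS
      have hS' : S.card = m := (Finset.mem_powersetCard.1 hS).2
      have : ((Finset.univ.filter fun c : Fin n → Option Bool => (supp c).card = m).filter
          fun c => supp c = S) = Fintype.piFinset (fun i => if i ∈ S then
            ({some true, some false} : Finset (Option Bool)) else {none}) := by
        ext c
        simp only [Finset.mem_filter, Finset.mem_univ, true_and, Fintype.mem_piFinset]
        constructor
        · rintro ⟨_, h⟩ i
          subst h
          rcases hc : c i with _ | _ | _ <;> simp [supp, hc]
        · intro h
          have : supp c = S := by
            ext i
            have := h i
            by_cases hi : i ∈ S
            · simp [hi] at this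
              rcases this with h | h <;> simp [supp, h, hi]
            · simp [hi] at this
              simp [supp, this, hi]
          exact ⟨by rw [this, hS'], this⟩
      rw [this, Fintype.card_piFinset]
      have h2 : ∀ i, (if i ∈ S then ({some true, some false} : Finset (Option Bool))
          else {none}).card = if i ∈ S then 2 else 1 := by
        intro i; split_ifs <;> simp
      simp only [h2]
      rw [Finset.prod_ite]
      simp [hS']
    rw [Finset.sum_congr rfl key]
    simp [mul_comm]
  · intro c hc
    simp only [Finset.coe_filter, Finset.mem_univ, true_and, Set.mem_ofPred_eq] at hc
    simp [Finset.mem_powersetCard, hc]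

lemma supp_none {n : ℕ} (d : Fin n → Option Bool) (i : Fin n) :
    supp (Function.update d i none) = (supp d).erase i := by
  ext j
  by_cases h : j = i
  · subst h; simp [supp]
  · simp [supp, h]

lemma supp_some {n : ℕ} (d : Fin n → Option Bool) (i : Fin n) (b : Bool) :
    supp (Function.update d i (some b)) = insert i (supp d) := by
  ext j
  by_cases h : j = i
  · subst h; simp [supp]
  · simp [supp, h]

/-- cardinality bound from an injection -/
lemma many_facets {n : ℕ} (f : (Fin n → Bool) → Bool) (c : Fin n → Option Bool)
    (hc : ¬ CanalizesOn f c) (h2 : 2 ≤ ((supp c)ᶜ).card) :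
    ∃ T : Finset (Fin n × Bool), ((supp c)ᶜ).card ≤ T.card ∧
      ∀ p ∈ T, p.1 ∉ supp c ∧ ¬ CanalizesOn f (Function.update c p.1 (some p.2)) := by
  classical
  by_cases h : ∃ i, i ∉ supp c ∧ ∀ b, CanalizesOn f (Function.update c i (some b))
  · obtain ⟨i, hi, hb⟩ := h
    have hi' : c i = none := by simpa [supp] using hi
    refine ⟨((supp c)ᶜ.erase i) ×ˢ Finset.univ, ?_, ?_⟩
    · rw [Finset.card_product, Finset.card_erase_of_mem (by simpa using hi)]
      rw [Finset.card_univ, Fintype.card_bool]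
      omega
    · rintro ⟨j, a⟩ hp
      simp only [Finset.mem_product, Finset.mem_erase, Finset.mem_compl, Finset.mem_univ,
        and_true] at hp
      refine ⟨hp.2, ?_⟩
      have hj' : c j = none := by simpa [supp] using hp.2
      rintro ⟨v, hv⟩
      apply hc
      refine ⟨v, ?_⟩
      intro x hx
      obtain ⟨w, hw⟩ := hb (x i)
      have e1 : f x = w := by
        apply hw
        intro l t hl
        by_cases hli : l = i
        · subst hli; simpa using hl
        · exact hx l t (by simpa [hli] using hl)
      have e2 : f (Function.update x j a) = w := by
        apply hw
        intro l t hl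
        by_cases hli : l = i
        · subst hli
          simpa [Ne.symm hp.1] using hl
        · by_cases hlj : l = j
          · subst hlj
            simp [hli, hj'] at hl
          · simpa [hlj] using hx l t (by simpa [hli] using hl)
      have e3 : f (Function.update x j a) = v := by
        apply hv
        intro l t hl
        by_cases hlj : l = j
        · subst hlj
          simpa using hl
        · simpa [hlj] using hx l t (by simpa [hlj] using hl)
      rw [e1, ← e2, e3]
  · push Not at h
    choose! b hb using h
    refine ⟨(supp c)ᶜ.image fun i => (i, b i), ?_, ?_⟩
    · rw [Finset.card_image_of_injective]
      intro i j hij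
      exact (Prod.ext_iff.1 hij).1
    · intro p hp
      obtain ⟨i, hi, rfl⟩ := Finset.mem_image.1 hp
      have hi' : i ∉ supp c := by simpa using hi
      exact ⟨hi', hb i hi'⟩

lemma step {n : ℕ} (f : (Fin n → Bool) → Bool) (m : ℕ) (hm : m + 2 ≤ n) :
    (Q f m).card * (n - m) ≤ (Q f (m + 1)).card * (m + 1) := by
  classical
  apply Finset.card_mul_le_card_mul
    (fun c d => ∃ i, i ∈ supp d ∧ c = Function.update d i none)
  · intro c hc
    simp only [Q, Finset.mem_filter, Finset.mem_univ, true_and] at hc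
    have hcc : ((supp c)ᶜ).card = n - m := by rw [Finset.card_compl]; simp [hc.1]
    obtain ⟨T, hT, hT'⟩ := many_facets f c hc.2 (by omega)
    rw [← hcc]
    refine hT.trans ?_
    apply Finset.card_le_card_of_injOn (fun p => Function.update c p.1 (some p.2))
    · intro p hp
      obtain ⟨h1, h2⟩ := hT' p hp
      have h1' : c p.1 = none := by simpa [supp] using h1
      simp only [Finset.mem_coe, Finset.mem_bipartiteAbove, Q, Finset.mem_filter,
        Finset.mem_univ, true_and]
      refine ⟨⟨?_, h2⟩, p.1, ?_, ?_⟩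
      · rw [supp_some, Finset.card_insert_of_notMem h1, hc.1]
      · rw [supp_some]; simp
      · rw [Function.update_idem, ← h1', Function.update_eq_self]
    · rintro ⟨i, a⟩ hp ⟨j, b⟩ hq hpq
      have h1 : c i = none := by simpa [supp] using (hT' _ hp).1
      have := congrFun hpq i
      by_cases hij : i = j
      · subst hij
        simpa using this
      · simp [hij, h1] at this
  · intro d hd
    simp only [Q, Finset.mem_filter, Finset.mem_univ, true_and] at hd
    rw [← hd.1]
    refine le_trans (Finset.card_le_card ?_)
      (Finset.card_image_le (s := supp d) (f := fun i => Function.update d i none))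
    intro c hc
    obtain ⟨_, i, hi, h⟩ := Finset.mem_bipartiteBelow _ |>.1 hc
    exact Finset.mem_image.2 ⟨i, hi, h.symm⟩

lemma base {n : ℕ} (f : (Fin n → Bool) → Bool) (m : ℕ) (hm : m + 1 = n) :
    2 * (Q f m).card ≤
      (Finset.univ.filter fun p : (Fin n → Bool) × Fin n =>
        f p.1 ≠ f (Function.update p.1 p.2 (!(p.1 p.2)))).card := by
  classical
  have : 2 * (Q f m).card = ((Finset.univ : Finset Bool) ×ˢ Q f m).card := by
    rw [Finset.card_product]; simp
  rw [this]
  apply Finset.card_le_card_of_surjOn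
    (fun p : (Fin n → Bool) × Fin n =>
      (p.1 p.2, Function.update (fun j => some (p.1 j)) p.2 none))
  rintro ⟨b, c⟩ hbc
  simp only [Finset.coe_product, Set.mem_prod, Finset.mem_coe, Q, Finset.mem_filter,
    Finset.mem_univ, true_and] at hbc
  obtain ⟨h1, h2⟩ := hbc
  have hcc : ((supp c)ᶜ).card = 1 := by rw [Finset.card_compl]; simp [h1]; omega
  obtain ⟨i, hi⟩ := Finset.card_eq_one.1 hcc
  have hn : ∀ j, c j = none ↔ j = i := by
    intro j
    have : j ∈ (supp c)ᶜ ↔ j ∈ ({i} : Finset _) := by rw [hi]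
    simpa [supp] using this
  have hxi : ((c i).getD b) = b := by simp [(hn i).2 rfl]
  refine ⟨(fun j => (c j).getD b, i), ?_, ?_⟩
  · simp only [Finset.coe_filter, Finset.mem_univ, true_and, Set.mem_ofPred_eq]
    intro heq
    apply h2
    refine ⟨f (fun j => (c j).getD b), ?_⟩
    intro y hy
    have hyj : ∀ j, j ≠ i → y j = (c j).getD b := by
      intro j hj
      rcases hcj : c j with _ | a
      · exact absurd ((hn j).1 hcj) hj
      · simpa using hy j a hcj
    by_cases hyi : y i = b
    · congr 1
      funext j
      by_cases hj : j = i
      · subst hj; rw [hyi, hxi]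
      · exact hyj j hj
    · rw [heq]
      congr 1
      funext j
      by_cases hj : j = i
      · subst hj
        simp only [Function.update_self, hxi]
        cases b <;> simpa using hyi
      · simp [hj, hyj j hj]
  · simp only [hxi]
    congr 1
    funext j
    by_cases hj : j = i
    · subst hj; simp [(hn j).2 rfl]
    · rcases hcj : c j with _ | a
      · exact absurd ((hn j).1 hcj) hj
      · simp [hj, hcj]

lemma one_sub {n : ℕ} (f : (Fin n → Bool) → Bool) (m : ℕ) (hm : m ≤ n) :
    1 - canalizingProportion n f m = (Q f m).card / (2 ^ m * (n.choose m) : ℝ) := by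
  classical
  have hpos : (0 : ℝ) < 2 ^ m * (n.choose m) := by
    have := Nat.choose_pos hm
    positivity
  have h := card_total n m
  rw [← Finset.card_filter_add_card_filter_not (p := fun c => CanalizesOn f c)] at h
  rw [Finset.filter_filter, Finset.filter_filter] at h
  have hN : Nat.card {c : Fin n → Option Bool //
      (Finset.univ.filter fun i => (c i).isSome).card = m ∧ CanalizesOn f c} =
      (Finset.univ.filter fun c : Fin n → Option Bool =>
        (supp c).card = m ∧ CanalizesOn f c).card := by
    rw [Nat.card_eq_fintype_card, Fintype.card_subtype]
    rfl
  have hQ : (Q f m).card = (Finset.univ.filter fun c : Fin n → Option Bool =>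
        (supp c).card = m ∧ ¬ CanalizesOn f c).card := by
    unfold Q; congr
  unfold canalizingProportion
  rw [hN, hQ, eq_div_iff hpos.ne', sub_mul, div_mul_cancel₀ _ hpos.ne', one_mul]
  have h' := congrArg (Nat.cast : ℕ → ℝ) h
  push_cast at h'
  linarith

lemma step_real {n : ℕ} (f : (Fin n → Bool) → Bool) (m : ℕ) (hm : m + 2 ≤ n) :
    1 - canalizingProportion n f m ≤ 2 * (1 - canalizingProportion n f (m + 1)) := by
  rw [one_sub f m (by omega), one_sub f (m + 1) (by omega)]
  have hs := step f m hm
  have hc := Nat.choose_succ_right_eq n m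
  have p1 : (0 : ℝ) < n.choose m := by exact_mod_cast Nat.choose_pos (by omega)
  have p2 : (0 : ℝ) < n.choose (m + 1) := by exact_mod_cast Nat.choose_pos (by omega)
  have p3 : (0 : ℝ) < ((n - m : ℕ) : ℝ) := by exact_mod_cast (by omega : 0 < n - m)
  have hs' : ((Q f m).card : ℝ) * ((n - m : ℕ) : ℝ) ≤ (Q f (m + 1)).card * (m + 1) := by
    exact_mod_cast hs
  have hc' : (n.choose (m + 1) : ℝ) * (m + 1) = n.choose m * ((n - m : ℕ) : ℝ) := by
    exact_mod_cast hc
  have e : 2 * (((Q f (m + 1)).card : ℝ) / (2 ^ (m + 1) * (n.choose (m + 1)))) =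
      ((Q f (m + 1)).card : ℝ) / (2 ^ m * (n.choose (m + 1))) := by
    rw [pow_succ]; field_simp
  rw [e, div_le_div_iff₀ (by positivity) (by positivity)]
  have h3 : ((Q f m).card : ℝ) * n.choose (m + 1) ≤ (Q f (m + 1)).card * n.choose m := by
    have hm1 : (0 : ℝ) < m + 1 := by positivity
    refine le_of_mul_le_mul_right ?_ p3
    calc ((Q f m).card : ℝ) * n.choose (m + 1) * ((n - m : ℕ) : ℝ)
        = ((Q f m).card : ℝ) * ((n - m : ℕ) : ℝ) * n.choose (m + 1) := by ring
      _ ≤ (Q f (m + 1)).card * (m + 1) * n.choose (m + 1) := by gcongr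
      _ = (Q f (m + 1)).card * (n.choose (m + 1) * (m + 1)) := by ring
      _ = _ := by rw [hc']; ring
  have : (0 : ℝ) < 2 ^ m := by positivity
  nlinarith

lemma base_real {n : ℕ} (f : (Fin n → Bool) → Bool) (m : ℕ) (hm : m + 1 = n) :
    1 - canalizingProportion n f m ≤ normAvgSensitivity n f := by
  rw [one_sub f m (by omega)]
  have hb := base f m hm
  have hS : ∑ x : Fin n → Bool, ∑ i : Fin n,
      (if f x ≠ f (Function.update x i (!(x i))) then (1 : ℝ) else 0) =
      ((Finset.univ.filter fun p : (Fin n → Bool) × Fin n =>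
        f p.1 ≠ f (Function.update p.1 p.2 (!(p.1 p.2)))).card : ℝ) := by
    rw [← Fintype.sum_prod_type']
    rw [Finset.sum_boole]
  unfold normAvgSensitivity
  rw [hS]
  have hb' : (2 : ℝ) * (Q f m).card ≤ ((Finset.univ.filter fun p : (Fin n → Bool) × Fin n =>
        f p.1 ≠ f (Function.update p.1 p.2 (!(p.1 p.2)))).card : ℝ) := by exact_mod_cast hb
  have hch : n.choose m = n := by subst hm; simp
  have hn : (0 : ℝ) < n := by exact_mod_cast (by omega : 0 < n)
  have hp : (2 : ℝ) ^ n = 2 ^ m * 2 := by rw [← hm, pow_succ]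
  rw [hch, hp, one_div, inv_mul_eq_div, div_le_div_iff₀ (by positivity) (by positivity)]
  have : (0 : ℝ) < 2 ^ m * n := by positivity
  nlinarith

lemma main {n : ℕ} (f : (Fin n → Bool) → Bool) (j : ℕ) (hj : j + 1 ≤ n) :
    1 - canalizingProportion n f (n - (j + 1)) ≤ 2 ^ j * normAvgSensitivity n f := by
  induction j with
  | zero => simpa using base_real f (n - 1) (by omega)
  | succ j ih =>
    have h1 := ih (by omega)
    have h2 := step_real f (n - (j + 1 + 1)) (by omega)
    rw [show n - (j + 1 + 1) + 1 = n - (j + 1) by omega] at h2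
    rw [pow_succ]
    linarith

end SensLB

theorem sensitivity_lower_bound (n k : ℕ) (f : (Fin n → Bool) → Bool)
    (hk0 : 0 < k) (hkn : k ≤ n) :
    (1 / 2 ^ (k - 1)) * (1 - canalizingProportion n f (n - k)) ≤ normAvgSensitivity n f := by
  obtain ⟨j, rfl⟩ : ∃ j, k = j + 1 := ⟨k - 1, by omega⟩
  have h := SensLB.main f j hkn
  rw [Nat.add_sub_cancel, one_div, inv_mul_le_iff₀ (by positivity)]
  exact h
end

section
/- For any Boolean function f : {0,1}^n → {0,1} with n ≥ 1, the normalized average sensitivity satisfies s(f) = 1 − P_{n−1}(f). -/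
open Finset

theorem canalizes_iff_s17 {n : ℕ} (f : (Fin n → Bool) → Bool) (x : Fin n → Bool) (i : Fin n) :
    CanalizesOn f (Function.update (fun j => some (x j)) i none) ↔
      f x = f (Function.update x i (!(x i))) := by
  constructor
  · rintro ⟨b, hb⟩
    rw [hb x, hb (Function.update x i (!(x i)))]
    · intro j a h
      by_cases hj : j = i
      · subst hj; simp at h
      · simpa [hj] using h
    · intro j a h
      by_cases hj : j = i
      · subst hj; simp at h
      · simpa [hj] using h
  · intro h
    refine ⟨f x, fun y hy => ?_⟩
    have hy' : ∀ j, j ≠ i → y j = x j := fun j hj => hy j (x j) (by simp [hj])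
    by_cases hi : y i = x i
    · congr 1
      funext j
      by_cases hj : j = i
      · subst hj; exact hi
      · exact hy' j hj
    · rw [h]
      congr 1
      funext j
      by_cases hj : j = i
      · subst hj
        simp only [Function.update_self]
        revert hi
        cases y j <;> cases x j <;> simp
      · simp [hj, hy' j hj]

theorem card_isSome_iff {n : ℕ} (hn : 1 ≤ n) (c : Fin n → Option Bool) :
    (Finset.univ.filter fun i => (c i).isSome).card = n - 1 ↔
      ∃ i, ∀ j, c j = none ↔ j = i := by
  have h := Finset.card_filter_add_card_filter_not (s := (Finset.univ : Finset (Fin n)))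
    (fun i => (c i).isSome = true)
  rw [Finset.card_univ, Fintype.card_fin] at h
  have h2 : (Finset.univ.filter fun i => (c i).isSome).card = n - 1 ↔
      (Finset.univ.filter fun i => ¬ (c i).isSome = true).card = 1 := by omega
  rw [h2, Finset.card_eq_one]
  simp [Finset.ext_iff]

theorem card_pairs {n : ℕ} (hn : 1 ≤ n) (f : (Fin n → Bool) → Bool) :
    Nat.card {p : (Fin n → Bool) × Fin n // f p.1 = f (Function.update p.1 p.2 (!(p.1 p.2)))} =
    2 * Nat.card {c : Fin n → Option Bool //
      (Finset.univ.filter fun i => (c i).isSome).card = n - 1 ∧ CanalizesOn f c} := by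
  have h2 : 2 = Nat.card Bool := by simp
  rw [h2, ← Nat.card_prod]
  refine Nat.card_eq_of_bijective (fun p => (p.1.1 p.1.2,
    ⟨Function.update (fun j => some (p.1.1 j)) p.1.2 none, ?_, ?_⟩)) ⟨?_, ?_⟩
  · rw [card_isSome_iff hn]
    refine ⟨p.1.2, fun j => ?_⟩
    by_cases hj : j = p.1.2
    · simp [hj]
    · simp [hj]
  · exact (canalizes_iff_s17 f _ _).2 p.2
  · rintro ⟨⟨x, i⟩, hx⟩ ⟨⟨y, j⟩, hy⟩ h
    simp only [Prod.mk.injEq, Subtype.mk.injEq] at h ⊢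
    obtain ⟨h1, h3⟩ := h
    have hij : i = j := by
      by_contra hij
      have := congrFun h3 i
      simp [hij] at this
    subst hij
    refine ⟨?_, rfl⟩
    funext k
    by_cases hk : k = i
    · subst hk; exact h1
    · have := congrFun h3 k
      simpa [hk] using this
  · rintro ⟨b, c, hc, hf⟩
    obtain ⟨i, hi⟩ := (card_isSome_iff hn c).1 hc
    have hcc : Function.update (fun j => some ((c j).getD b)) i none = c := by
      funext j
      by_cases hj : j = i
      · subst hj; simp [(hi j).2 rfl]
      · have h3 : c j ≠ none := fun h => hj ((hi j).1 h)
        obtain ⟨a, ha⟩ := Option.ne_none_iff_exists'.1 h3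
        simp [hj, ha]
    refine ⟨⟨(fun j => (c j).getD b, i), ?_⟩, ?_⟩
    · rw [← hcc] at hf
      exact (canalizes_iff_s17 f _ _).1 hf
    · simp only [Prod.mk.injEq, Subtype.mk.injEq]
      exact ⟨by simp [(hi i).2 rfl], hcc⟩

theorem sensitivity_eq_one_sub_P (n : ℕ) (hn : 1 ≤ n) (f : (Fin n → Bool) → Bool) :
    normAvgSensitivity n f = 1 - canalizingProportion n f (n - 1) := by
  have key := card_pairs hn f
  have hs : (∑ x : Fin n → Bool, ∑ i : Fin n,
      (if f x ≠ f (Function.update x i (!(x i))) then (1 : ℝ) else 0)) =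
      (n : ℝ) * 2 ^ n - (Nat.card {p : (Fin n → Bool) × Fin n //
        f p.1 = f (Function.update p.1 p.2 (!(p.1 p.2)))} : ℝ) := by
    rw [Nat.card_eq_fintype_card, Fintype.card_subtype, ← Fintype.sum_prod_type'
      (f := fun (x : Fin n → Bool) (i : Fin n) =>
        if f x ≠ f (Function.update x i (!(x i))) then (1 : ℝ) else 0), Finset.sum_boole]
    have h := Finset.card_filter_add_card_filter_not
      (s := (Finset.univ : Finset ((Fin n → Bool) × Fin n)))
      (fun p => f p.1 = f (Function.update p.1 p.2 (!(p.1 p.2))))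
    rw [Finset.card_univ, Fintype.card_prod, Fintype.card_fun, Fintype.card_bool,
      Fintype.card_fin] at h
    have h' := congrArg (Nat.cast : ℕ → ℝ) h
    push_cast at h'
    simp only [ne_eq]
    linarith
  unfold normAvgSensitivity canalizingProportion
  rw [hs, key]
  obtain ⟨m, rfl⟩ : ∃ m, n = m + 1 := ⟨n - 1, by omega⟩
  have hm : ((m : ℝ) + 1) ≠ 0 := by positivity
  simp only [Nat.add_sub_cancel, Nat.choose_succ_self_right]
  push_cast
  field_simp
  try ring
end

section
/- Let n ≥ 2, b ∈ {0,1}, and let f : {0,1}^n → {0,1} be the parity function f(x_1,…,x_n) = x_1 ⊕ x_2 ⊕ ⋯ ⊕ x_n ⊕ b, where ⊕ denotes addition modulo 2. Then the canalizing strength satisfies c(f) = 0. -/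
open Finset

/-- The canalizing strength of a Boolean function on `n` variables. -/
noncomputable def canalizingStrength (n : ℕ) (f : (Fin n → Bool) → Bool) : ℝ :=
  (1 / ((n : ℝ) - 1)) *
    ∑ k ∈ Finset.Icc 1 (n - 1), ((2 ^ k : ℝ) / ((2 ^ k : ℝ) - 1)) * canalizingProportion n f k

/-- `f` is the parity function with constant `b`:
f(x) = x₁ ⊕ x₂ ⊕ ⋯ ⊕ xₙ ⊕ b, where ⊕ is addition modulo 2. -/
def IsParity {n : ℕ} (f : (Fin n → Bool) → Bool) (b : Bool) : Prop :=
  ∀ x : Fin n → Bool,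
    f x = xor b (decide ((∑ i : Fin n, (if x i then (1 : ZMod 2) else 0)) = 1))

theorem parity_not_canalizesOn {n : ℕ} (f : (Fin n → Bool) → Bool) (b : Bool)
    (hf : IsParity f b) (c : Fin n → Option Bool) (j : Fin n) (hj : c j = none) :
    ¬ CanalizesOn f c := by
  rintro ⟨v, hv⟩
  have key : ∀ t : Bool, f (Function.update (fun i => (c i).getD false) j t) = v := by
    intro t
    apply hv
    intro i a hi
    have hij : i ≠ j := by
      rintro rfl
      rw [hj] at hi
      cases hi
    simp [Function.update_of_ne hij, hi]
  have expand : ∀ t : Bool,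
      (∑ i : Fin n, (if Function.update (fun i => (c i).getD false) j t i
        then (1 : ZMod 2) else 0)) =
      (if t then 1 else 0) + ∑ i ∈ Finset.univ.erase j,
        (if (c i).getD false then (1 : ZMod 2) else 0) := by
    intro t
    rw [← Finset.add_sum_erase _ _ (Finset.mem_univ j), Function.update_self]
    congr 1
    apply Finset.sum_congr rfl
    intro i hi
    rw [Function.update_of_ne (Finset.ne_of_mem_erase hi)]
  have h := (key true).trans (key false).symm
  rw [hf, hf, expand, expand] at h
  generalize (∑ i ∈ Finset.univ.erase j,
        (if (c i).getD false then (1 : ZMod 2) else 0)) = s at h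
  clear hf expand
  revert s b
  decide

theorem canalizingStrength_parity (n : ℕ) (hn : 2 ≤ n) (b : Bool)
    (f : (Fin n → Bool) → Bool) (hf : IsParity f b) :
    canalizingStrength n f = 0 := by
  unfold canalizingStrength
  rw [Finset.sum_eq_zero, mul_zero]
  intro k hk
  rw [Finset.mem_Icc] at hk
  have : IsEmpty {c : Fin n → Option Bool //
      (Finset.univ.filter fun i => (c i).isSome).card = k ∧ CanalizesOn f c} := by
    refine ⟨fun ⟨c, hc, hcan⟩ => ?_⟩
    by_cases h : ∃ j, c j = none
    · obtain ⟨j, hj⟩ := h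
      exact parity_not_canalizesOn f b hf c j hj hcan
    · push Not at h
      have : (Finset.univ.filter fun i => (c i).isSome) = Finset.univ := by
        apply Finset.filter_true_of_mem
        intro i _
        exact Option.isSome_iff_ne_none.mpr (h i)
      rw [this, Finset.card_univ, Fintype.card_fin] at hc
      omega
  unfold canalizingProportion
  rw [Nat.card_of_isEmpty]
  simp
end
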